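/- Let q ∈ (2,3] and let {x^k}, {y^k} be generated by Algorithm 1. Suppose Assumption 2 holds and that ϱ < (1−ς)/(1+ς+L_f) for some ς ∈ (0,1), where L_f is a Lipschitz constant of ∇f on the set ℒ_F(x⁰) + μ̄𝔹 for some μ̄ ∈ (0,1). Then for every second-order stationary point x̄ ∈ 𝒳* there exist c₁ > 0, δ > 0 and k̄ ∈ ℕ such that ‖y^k − x^k‖ ≤ c₁ · dist(x^k, 𝒳*) for all k ≥ k̄ with x^k ∈ B(x̄, δ). -/

import Mathlib

open Filter Metric Real Set
open scoped InnerProductSpace Topology Pointwise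

/-- The convex subdifferential of an extended-real-valued function `g` at `x`. -/
noncomputable def ESubdiff {X : Type*} [NormedAddCommGroup X] [InnerProductSpace ℝ X]
    (g : X → EReal) (x : X) : Set X :=
  {v | ∀ z : X, g x + ((⟪v, z - x⟫_ℝ : ℝ) : EReal) ≤ g z}

/-- Values of the proximal mapping of a proper function lie in its domain. -/
theorem prox_ne_top {X : Type*} [NormedAddCommGroup X] {g : X → EReal} (hg : ∃ z, g z ≠ ⊤) {p w : X}
    (hp : ∀ z : X, ((1/2 * ‖p - w‖ ^ 2 : ℝ) : EReal) + g p ≤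
      ((1/2 * ‖z - w‖ ^ 2 : ℝ) : EReal) + g z) : g p ≠ ⊤ := by
  intro h
  obtain ⟨z, hz⟩ := hg
  have h1 := hp z
  rw [h, EReal.coe_add_top, top_le_iff] at h1
  exact EReal.add_ne_top (EReal.coe_ne_top _) hz h1

section Aux

variable {X : Type*} [NormedAddCommGroup X] [InnerProductSpace ℝ X]

/-- An extended real different from `⊤` and `⊥` is a real number. -/
theorem EReal.exists_real_eq {a : EReal} (h : a ≠ ⊤) (hbot : a ≠ ⊥) : ∃ b : ℝ, a = b :=
  ⟨a.toReal, (EReal.coe_toReal h hbot).symm⟩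

/-- A point with a subgradient of a proper function lies in the domain. -/
theorem ESubdiff.ne_top {g : X → EReal} (hg : ∃ z, g z ≠ ⊤) {v p : X}
    (hv : v ∈ ESubdiff g p) : g p ≠ ⊤ := by
  intro h
  obtain ⟨z, hz⟩ := hg
  have := hv z
  rw [h, EReal.top_add_coe] at this
  exact hz (top_le_iff.1 this)

/-- The convex subdifferential is a monotone operator. -/
theorem ESubdiff.inner_sub_nonneg {g : X → EReal} (hg : ∃ z, g z ≠ ⊤) (hbot : ∀ z, g z ≠ ⊥)
    {a b p z : X} (ha : a ∈ ESubdiff g p) (hb : b ∈ ESubdiff g z) : 0 ≤ ⟪a - b, p - z⟫_ℝ := by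
  obtain ⟨s, hs⟩ := EReal.exists_real_eq (ESubdiff.ne_top hg ha) (hbot p)
  obtain ⟨t, ht⟩ := EReal.exists_real_eq (ESubdiff.ne_top hg hb) (hbot z)
  have h1 := ha z
  have h2 := hb p
  rw [hs, ht] at h1 h2
  norm_cast at h1 h2
  have h3 : ⟪a, z - p⟫_ℝ = -⟪a, p - z⟫_ℝ := by rw [← inner_neg_right, neg_sub]
  rw [inner_sub_left]
  linarith

/-- Optimality condition for the proximal mapping of a convex function. -/
theorem sub_prox_mem_ESubdiff {g : X → EReal} (hg : ∃ z, g z ≠ ⊤) (hbot : ∀ z, g z ≠ ⊥)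
    (hconv : ∀ u w : X, ∀ t : ℝ, t ∈ Set.Ioo (0:ℝ) 1 →
        g (t • u + (1 - t) • w) ≤ (t : EReal) * g u + ((1 - t : ℝ) : EReal) * g w)
    {p w : X} (hp : ∀ z : X, ((1/2 * ‖p - w‖ ^ 2 : ℝ) : EReal) + g p ≤
      ((1/2 * ‖z - w‖ ^ 2 : ℝ) : EReal) + g z) : w - p ∈ ESubdiff g p := by
  intro z
  by_cases hz : g z = ⊤
  · rw [hz]; exact le_top
  obtain ⟨a, ha⟩ := EReal.exists_real_eq (prox_ne_top hg hp) (hbot p)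
  obtain ⟨b, hb⟩ := EReal.exists_real_eq hz (hbot z)
  have key : ∀ t ∈ Set.Ioo (0:ℝ) 1,
      a - b - ⟪p - w, z - p⟫_ℝ ≤ t / 2 * ‖z - p‖ ^ 2 := by
    intro t ht
    have h1 := (hp (t • z + (1 - t) • p)).trans (add_le_add_right (hconv z p t ht) _)
    rw [ha, hb] at h1
    norm_cast at h1
    have h2 : t • z + (1 - t) • p - w = (p - w) + t • (z - p) := by module
    rw [h2, norm_add_sq_real, inner_smul_right, norm_smul, mul_pow, Real.norm_eq_abs,
      sq_abs] at h1
    have h3 : t * (a - b - ⟪p - w, z - p⟫_ℝ) ≤ t * (t / 2 * ‖z - p‖ ^ 2) := by linarith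
    exact le_of_mul_le_mul_left h3 ht.1
  rw [ha, hb]
  norm_cast
  have h4 : ⟪w - p, z - p⟫_ℝ = -⟪p - w, z - p⟫_ℝ := by rw [← inner_neg_left, neg_sub]
  by_contra! hc
  set c := a - b - ⟪p - w, z - p⟫_ℝ with hcdef
  have hc0 : 0 < c := by linarith
  have hN : 0 ≤ ‖z - p‖ ^ 2 := by positivity
  have hd : 0 < c + ‖z - p‖ ^ 2 + 1 := by positivity
  have h5 := key (c / (c + ‖z - p‖ ^ 2 + 1)) ⟨by positivity, by rw [div_lt_one hd]; linarith⟩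
  have h6 : c / (c + ‖z - p‖ ^ 2 + 1) * (c + ‖z - p‖ ^ 2 + 1) = c := by field_simp
  have h7 : 0 < c / (c + ‖z - p‖ ^ 2 + 1) := by positivity
  nlinarith

/-- First-order Taylor estimate with a Lipschitz derivative. -/
theorem norm_sub_sub_fderiv_le {f' : X → X} {f'' : X → X →L[ℝ] X} {B : Set X} {K : ℝ}
    (hB : Convex ℝ B) (hf : ∀ z ∈ B, HasFDerivAt f' (f'' z) z)
    (hK : ∀ a ∈ B, ∀ b ∈ B, ‖f'' a - f'' b‖ ≤ K * ‖a - b‖) (hK0 : 0 ≤ K)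
    {x z : X} (hx : x ∈ B) (hz : z ∈ B) :
    ‖f' x - f' z - f'' z (x - z)‖ ≤ K * ‖x - z‖ ^ 2 := by
  have hsub : segment ℝ z x ⊆ B := hB.segment_subset hz hx
  have h := (convex_segment z x).norm_image_sub_le_of_norm_hasFDerivWithin_le'
    (f := f') (f' := f'') (φ := f'' z) (C := K * ‖x - z‖)
    (fun u hu => (hf u (hsub hu)).hasFDerivWithinAt)
    (fun u hu => (hK u (hsub hu) z hz).trans
      (mul_le_mul_of_nonneg_left (by
        obtain ⟨θ, hθ, rfl⟩ := (segment_eq_image' ℝ z x ▸ hu)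
        simp only [add_sub_cancel_left, norm_smul, Real.norm_eq_abs, abs_of_nonneg hθ.1]
        exact mul_le_of_le_one_left (norm_nonneg _) hθ.2) hK0))
    (left_mem_segment ℝ z x) (right_mem_segment ℝ z x)
  rw [pow_two, ← mul_assoc]
  exact h

/-- Second-order Taylor estimate with a Lipschitz second derivative. -/
theorem sub_quadratic_model_le [CompleteSpace X] {f : X → ℝ} {f' : X → X} {f'' : X → X →L[ℝ] X}
    {B : Set X} {K : ℝ}
    (hB : Convex ℝ B) (hf1 : ∀ z ∈ B, HasGradientAt f (f' z) z)
    (hf : ∀ z ∈ B, HasFDerivAt f' (f'' z) z)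
    (hK : ∀ a ∈ B, ∀ b ∈ B, ‖f'' a - f'' b‖ ≤ K * ‖a - b‖) (hK0 : 0 ≤ K)
    {x y : X} (hx : x ∈ B) (hy : y ∈ B) :
    f y - (f x + ⟪f' x, y - x⟫_ℝ + 1/2 * ⟪y - x, f'' x (y - x)⟫_ℝ) ≤ K * ‖y - x‖ ^ 3 := by
  obtain ⟨d, hd⟩ : ∃ d, d = y - x := ⟨_, rfl⟩
  rw [← hd]
  have hmem : ∀ t ∈ Set.Icc (0:ℝ) 1, x + t • d ∈ B := fun t ht =>
    hd ▸ hB.add_smul_sub_mem hx hy ht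
  have hder : ∀ t ∈ Set.Icc (0:ℝ) 1, HasDerivAt
      (fun t : ℝ => f (x + t • d) - (t * ⟪f' x, d⟫_ℝ + t ^ 2 * (1/2 * ⟪d, f'' x d⟫_ℝ)))
      (⟪f' (x + t • d), d⟫_ℝ - (1 * ⟪f' x, d⟫_ℝ + (2 * t) * (1/2 * ⟪d, f'' x d⟫_ℝ))) t := by
    intro t ht
    have hl : HasDerivAt (fun t : ℝ => x + t • d) d t := by
      simpa using ((hasDerivAt_id t).smul_const d).const_add x
    have h1 := (hf1 _ (hmem t ht)).hasFDerivAt.comp_hasDerivAt t hl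
    have h2 : HasDerivAt (fun t : ℝ => t ^ 2) (2 * t) t := by simpa using hasDerivAt_pow 2 t
    exact h1.sub (((hasDerivAt_id t).mul_const _).add (h2.mul_const _))
  have hbound : ∀ t ∈ Set.Ico (0:ℝ) 1,
      ‖⟪f' (x + t • d), d⟫_ℝ - (1 * ⟪f' x, d⟫_ℝ + (2 * t) * (1/2 * ⟪d, f'' x d⟫_ℝ))‖
        ≤ K * ‖d‖ ^ 3 := by
    intro t ht
    have h1 := norm_sub_sub_fderiv_le hB hf hK hK0 (hmem t ⟨ht.1, ht.2.le⟩) hx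
    rw [add_sub_cancel_left, map_smul, norm_smul, Real.norm_eq_abs, abs_of_nonneg ht.1] at h1
    have h2 : ⟪f' (x + t • d), d⟫_ℝ - (1 * ⟪f' x, d⟫_ℝ + (2 * t) * (1/2 * ⟪d, f'' x d⟫_ℝ))
        = ⟪f' (x + t • d) - f' x - t • f'' x d, d⟫_ℝ := by
      rw [inner_sub_left, inner_sub_left, real_inner_smul_left, real_inner_comm (f'' x d) d]
      ring
    rw [h2]
    calc _ ≤ ‖f' (x + t • d) - f' x - t • f'' x d‖ * ‖d‖ := norm_inner_le_norm _ _
      _ ≤ (K * (t * ‖d‖) ^ 2) * ‖d‖ := by gcongr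
      _ ≤ (K * (1 * ‖d‖) ^ 2) * ‖d‖ := by
          have := ht.1
          have := ht.2.le
          gcongr
      _ = K * ‖d‖ ^ 3 := by ring
  have h := norm_image_sub_le_of_norm_deriv_le_segment_01'
    (fun t ht => (hder t ht).hasDerivWithinAt) hbound
  have h' := (le_abs_self _).trans h
  simp only [one_smul, zero_smul, add_zero] at h'
  have hxd : x + d = y := by rw [hd, add_sub_cancel]
  rw [hxd] at h'
  linarith

/-- Sufficient decrease of a bounded below sequence forces the steps to vanish. -/
theorem tendsto_zero_of_sufficient_decrease {Φ D : ℕ → ℝ} {c q m : ℝ} (hc : 0 < c) (hq : 0 < q)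
    (hm : ∀ k, m ≤ Φ k) (hD : ∀ k, 0 ≤ D k) (h : ∀ k, Φ (k + 1) ≤ Φ k - c * D k ^ q) :
    Tendsto D atTop (𝓝 0) := by
  have hanti : Antitone Φ := antitone_nat_of_succ_le fun k =>
    (h k).trans (sub_le_self _ (mul_nonneg hc.le (rpow_nonneg (hD k) q)))
  have hl := tendsto_atTop_ciInf hanti ⟨m, by rintro _ ⟨k, rfl⟩; exact hm k⟩
  have hz : Tendsto (fun k => (Φ k - Φ (k + 1)) / c) atTop (𝓝 0) := by
    simpa using (hl.sub (hl.comp (tendsto_add_atTop_nat 1))).div_const c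
  have hp : Tendsto (fun k => D k ^ q) atTop (𝓝 0) := by
    refine squeeze_zero (fun k => rpow_nonneg (hD k) q) (fun k => ?_) hz
    rw [le_div_iff₀ hc]
    linarith [h k]
  have hr := hp.rpow_const (p := 1 / q) (Or.inr (by positivity))
  rw [zero_rpow (by positivity)] at hr
  refine hr.congr fun k => ?_
  rw [← rpow_mul (hD k), mul_one_div_cancel hq.ne', rpow_one]

/-- A bound on the regularization parameter, from a quadratic growth bound away from zero and a
cubic bound near zero. -/
theorem regularization_le {l D q σ ε K C₀ C₁ C₂ : ℝ} (hq : q ∈ Set.Ioc (2:ℝ) 3) (hσ : σ < 1)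
    (hl : 0 < l) (hD : 0 < D) (hε : 0 < ε) (hε1 : ε ≤ 1) (hK : 0 ≤ K) (hC₀ : 0 ≤ C₀)
    (hC₁ : 0 ≤ C₁) (hC₂ : 0 ≤ C₂)
    (hfar : l / q * D ^ q ≤ C₀ + C₁ * D + C₂ * D ^ 2)
    (hnear : D < ε → (1 - σ) * (l / q * D ^ q) ≤ K * D ^ 3) :
    l ≤ q * ((C₀ / ε ^ 2 + C₁ / ε + C₂) / ε ^ (q - 2)) + q * (K / (1 - σ)) := by
  have hq0 : 0 < q := by linarith [hq.1]
  have h1σ : 0 < 1 - σ := by linarith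
  have hlq : l = q * (l / q) := by field_simp
  have hlq0 : 0 < l / q := by positivity
  rw [hlq, ← mul_add]
  refine mul_le_mul_of_nonneg_left ?_ hq0.le
  set s := l / q
  have hA : 0 ≤ (C₀ / ε ^ 2 + C₁ / ε + C₂) / ε ^ (q - 2) := by positivity
  have hB : 0 ≤ K / (1 - σ) := by positivity
  rcases lt_or_ge D ε with h | h
  · have h3 : D ^ 3 ≤ D ^ q := by
      rw [← rpow_natCast D 3]
      exact rpow_le_rpow_of_exponent_ge hD (by linarith) (by simpa using hq.2)
    have h4 : s ≤ K / (1 - σ) := by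
      rw [le_div_iff₀ h1σ]
      have hp : 0 < D ^ q := rpow_pos_of_pos hD q
      refine le_of_mul_le_mul_right ?_ hp
      have := hnear h
      nlinarith [mul_le_mul_of_nonneg_left h3 hK]
    linarith
  · have hDq : D ^ q = D ^ (q - 2) * D ^ 2 := by
      rw [← rpow_natCast D 2, ← rpow_add hD]; norm_num
    have h5 : ε ^ (q - 2) ≤ D ^ (q - 2) := rpow_le_rpow hε.le h (by linarith [hq.1])
    have h6 : s ≤ (C₀ / ε ^ 2 + C₁ / ε + C₂) / ε ^ (q - 2) := by
      rw [le_div_iff₀ (by positivity)]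
      have hp : 0 < D ^ 2 := by positivity
      refine le_of_mul_le_mul_right ?_ hp
      have h7 : 1 ≤ D / ε := by rwa [one_le_div hε]
      have h8 : C₀ ≤ C₀ / ε ^ 2 * D ^ 2 := by
        have : C₀ / ε ^ 2 * D ^ 2 = C₀ * (D / ε) ^ 2 := by ring
        rw [this]
        exact le_mul_of_one_le_right hC₀ (one_le_pow₀ h7)
      have h9 : C₁ * D ≤ C₁ / ε * D ^ 2 := by
        have : C₁ / ε * D ^ 2 = C₁ * D * (D / ε) := by ring
        rw [this]
        exact le_mul_of_one_le_right (by positivity) h7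
      calc s * ε ^ (q - 2) * D ^ 2 ≤ s * D ^ (q - 2) * D ^ 2 := by gcongr
        _ = s * D ^ q := by rw [hDq]; ring
        _ ≤ _ := by linarith
    linarith

/-- The scalar inequality behind the error bound on the step. -/
theorem step_le_of_residual_inequality {s D e V ϱ ς Lf K l θ : ℝ} (hD : 0 < D) (hV0 : 0 ≤ V)
    (he : 0 ≤ e) (hV : V ≤ ϱ * s * D) (hϱ : ϱ ∈ Set.Ioo (0:ℝ) 1) (hς : ς ∈ Set.Ioo (0:ℝ) 1)
    (hLf : 0 ≤ Lf) (hK : 0 ≤ K) (hl : 0 < l) (hϱLf : (1 + Lf) * ϱ ≤ 1 - ς)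
    (hs : l * D ≤ s) (hs' : s ≤ ς / 16) (hθ : 0 < θ) (hθ1 : θ ≤ ς / 16)
    (hθ2 : 2 * K * θ ≤ ς / 8 * l)
    (hmain : s * D ^ 2 - s * D * (e + V) ≤
      ((1 + Lf) * V + K * (e ^ 2 + e * D)) * (D + e + V)) : θ * D ≤ e := by
  by_contra! hlt
  obtain ⟨hς0, hς1⟩ := hς
  obtain ⟨hϱ0, hϱ1⟩ := hϱ
  have hs0 : 0 < s := lt_of_lt_of_le (by positivity) hs
  have hV1 : V ≤ ς / 16 * D := hV.trans (by
    have : ϱ * s ≤ 1 * (ς / 16) := by gcongr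
    nlinarith)
  have he1 : e ≤ ς / 16 * D := hlt.le.trans (by gcongr)
  have hS : D + e + V ≤ (1 + ς / 8) * D := by linarith
  have hE : K * (e ^ 2 + e * D) ≤ ς / 8 * (s * D) := by
    have h1 : e ^ 2 + e * D ≤ 2 * θ * D ^ 2 := by
      have : e ≤ D := by nlinarith
      nlinarith
    calc K * (e ^ 2 + e * D) ≤ K * (2 * θ * D ^ 2) := by gcongr
      _ = (2 * K * θ) * D ^ 2 := by ring
      _ ≤ (ς / 8 * l) * D ^ 2 := by gcongr
      _ = ς / 8 * ((l * D) * D) := by ring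
      _ ≤ ς / 8 * (s * D) := by gcongr
  have hVL : (1 + Lf) * V ≤ (1 - ς) * (s * D) := by
    calc (1 + Lf) * V ≤ (1 + Lf) * (ϱ * s * D) := by gcongr
      _ = ((1 + Lf) * ϱ) * (s * D) := by ring
      _ ≤ _ := by gcongr
  have hsD : 0 < s * D := by positivity
  have hR : ((1 + Lf) * V + K * (e ^ 2 + e * D)) * (D + e + V) ≤
      ((1 - 7 * ς / 8) * (s * D)) * ((1 + ς / 8) * D) := by
    have h1 : (1 + Lf) * V + K * (e ^ 2 + e * D) ≤ (1 - 7 * ς / 8) * (s * D) := by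
      linarith
    have h2 : 0 ≤ 1 - 7 * ς / 8 := by linarith
    exact mul_le_mul h1 hS (by positivity) (by positivity)
  have h2 : s * D * (e + V) ≤ s * D * (ς / 8 * D) :=
    mul_le_mul_of_nonneg_left (by linarith) hsD.le
  have h3 : 0 < s * D * D := by positivity
  nlinarith [mul_pos h3 hς0, mul_pos h3 (mul_pos hς0 hς0)]


/-- The estimate obtained from monotonicity of the subdifferential at an inexact step `y` and a
reference point `z`. -/
theorem step_residual_inequality {x y z v a b : X} {A B : X →L[ℝ] X} {s Lf K : ℝ} (hs : 0 ≤ s)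
    (hmono : 0 ≤ ⟪v - (a + A (y - x) + s • (y - x)) + b, y - v - z⟫_ℝ)
    (hpsd : 0 ≤ ⟪y - v - z, B (y - v - z)⟫_ℝ) (hB : ‖B‖ ≤ Lf)
    (hT : ‖a - b - B (x - z)‖ ≤ K * ‖x - z‖ ^ 2) (hAB : ‖A - B‖ ≤ K * ‖x - z‖) :
    s * ‖y - x‖ ^ 2 - s * ‖y - x‖ * (‖x - z‖ + ‖v‖) ≤
      ((1 + Lf) * ‖v‖ + K * (‖x - z‖ ^ 2 + ‖x - z‖ * ‖y - x‖)) *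
        (‖y - x‖ + ‖x - z‖ + ‖v‖) := by
  have hw : y - v - z = (y - x) + ((x - z) - v) := by abel
  set w := y - v - z with hwdef
  set d := y - x with hd
  set u := x - z with hu
  have hsplit : v - (a + A d + s • d) + b
      = (v - (a - b - B u) - (A - B) d - B v) - B w - s • d := by
    have : w = d + (u - v) := hw
    rw [this]
    simp only [map_add, map_sub, sub_apply]
    abel
  rw [hsplit, inner_sub_left, inner_sub_left, real_inner_smul_left, real_inner_comm w (B w)]
    at hmono
  have hAd : ‖(A - B) d‖ ≤ K * ‖u‖ * ‖d‖ := (A - B).le_of_opNorm_le hAB d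
  have hBv : ‖B v‖ ≤ Lf * ‖v‖ := B.le_of_opNorm_le hB v
  have hE : ‖v - (a - b - B u) - (A - B) d - B v‖ ≤
      (1 + Lf) * ‖v‖ + K * (‖u‖ ^ 2 + ‖u‖ * ‖d‖) := by
    have h1 := norm_sub_le (v - (a - b - B u) - (A - B) d) (B v)
    have h2 := norm_sub_le (v - (a - b - B u)) ((A - B) d)
    have h3 := norm_sub_le v (a - b - B u)
    linarith
  have huv := norm_sub_le u v
  have hwn : ‖w‖ ≤ ‖d‖ + ‖u‖ + ‖v‖ := by
    rw [hw]
    linarith [norm_add_le d (u - v)]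
  have hdw : ‖d‖ ^ 2 - ‖d‖ * (‖u‖ + ‖v‖) ≤ ⟪d, w⟫_ℝ := by
    rw [hw, inner_add_right, real_inner_self_eq_norm_sq]
    have h1 := neg_le_of_abs_le (abs_real_inner_le_norm d (u - v))
    have h2 := mul_le_mul_of_nonneg_left huv (norm_nonneg d)
    linarith
  calc s * ‖d‖ ^ 2 - s * ‖d‖ * (‖u‖ + ‖v‖) = s * (‖d‖ ^ 2 - ‖d‖ * (‖u‖ + ‖v‖)) := by ring
    _ ≤ s * ⟪d, w⟫_ℝ := by gcongr
    _ ≤ ⟪v - (a - b - B u) - (A - B) d - B v, w⟫_ℝ := by linarith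
    _ ≤ ‖v - (a - b - B u) - (A - B) d - B v‖ * ‖w‖ := real_inner_le_norm _ _
    _ ≤ _ := mul_le_mul hE hwn (norm_nonneg _) ((norm_nonneg _).trans hE)

/-- Near a stationary point, the regularization parameters whose trial point fails the descent
test are uniformly bounded. -/
theorem exists_bound_of_failed_descent [CompleteSpace X] {f : X → ℝ} {g : X → EReal} {f' : X → X}
    {f'' : X → X →L[ℝ] X} {xb : X} {r K Lf F0 q σ : ℝ} (hr : 0 < r) (hK : 0 ≤ K)
    (hLf : 0 ≤ Lf) (hq : q ∈ Set.Ioc (2:ℝ) 3) (hσ : σ < 1)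
    (hg : ∃ z, g z ≠ ⊤) (hbot : ∀ z, g z ≠ ⊥) (hxb : -f' xb ∈ ESubdiff g xb)
    (hf1 : ∀ z ∈ ball xb r, HasGradientAt f (f' z) z)
    (hf2 : ∀ z ∈ ball xb r, HasFDerivAt f' (f'' z) z)
    (hlip : ∀ a ∈ ball xb r, ∀ b ∈ ball xb r, ‖f'' a - f'' b‖ ≤ K * ‖a - b‖)
    (hlip' : ∀ a ∈ ball xb r, ∀ b ∈ ball xb r, ‖f' a - f' b‖ ≤ Lf * ‖a - b‖)
    (hnorm : ∀ z ∈ ball xb r, ‖f'' z‖ ≤ Lf)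
    (hlow : ∀ z ∈ ball xb r, f xb - 1 ≤ f z) :
    ∃ M : ℝ, ∀ x ∈ ball xb (r / 2), ∀ y : X, ∀ a b l : ℝ, g x = a → g y = b → 0 < l →
      f x + a ≤ F0 →
      f x + ⟪f' x, y - x⟫_ℝ + 1/2 * ⟪y - x, f'' x (y - x)⟫_ℝ + l / q * ‖y - x‖ ^ q + b
        < f x + a →
      f x + a - σ * (l / q * ‖y - x‖ ^ q) < f y + b → l ≤ M := by
  obtain ⟨γ, hγ⟩ := EReal.exists_real_eq (ESubdiff.ne_top hg hxb) (hbot xb)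
  refine ⟨_, fun x hx y a b l ha hb hl hF0 hmodel hfail => regularization_le
    (D := ‖y - x‖) (ε := min (r / 2) 1) (C₀ := |F0 - f xb + 1 - γ| + ‖f' xb‖ * r)
    (C₁ := ‖f' xb‖ + Lf * r + ‖f' xb‖) (C₂ := Lf) hq hσ hl ?_ (by positivity) (min_le_right _ _) hK
    (by positivity) (by positivity) hLf ?_ ?_⟩
  · have hq0 : q ≠ 0 := by linarith [hq.1]
    rw [norm_pos_iff, sub_ne_zero]
    rintro rfl
    rw [hb] at ha
    have hba : b = a := by exact_mod_cast ha
    simp [hq0, hba] at hmodel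
  · have hxr : x ∈ ball xb r := ball_subset_ball (by linarith) hx
    have hxn : ‖x - xb‖ < r := mem_ball_iff_norm.1 hxr
    have h1 := hxb y
    rw [hγ, hb] at h1
    norm_cast at h1
    rw [inner_neg_left] at h1
    have h2 : ⟪f' xb, y - xb⟫_ℝ ≤ ‖f' xb‖ * (‖y - x‖ + r) := by
      refine (real_inner_le_norm _ _).trans (mul_le_mul_of_nonneg_left ?_ (norm_nonneg _))
      have : y - xb = (y - x) + (x - xb) := by abel
      rw [this]
      linarith [norm_add_le (y - x) (x - xb)]
    have h3 : ‖f' x‖ ≤ ‖f' xb‖ + Lf * r := by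
      have h := hlip' x hxr xb (mem_ball_self hr)
      have h' := mul_le_mul_of_nonneg_left hxn.le hLf
      linarith [norm_sub_norm_le (f' x) (f' xb)]
    have h4 : -⟪f' x, y - x⟫_ℝ ≤ (‖f' xb‖ + Lf * r) * ‖y - x‖ :=
      (neg_le_abs _).trans ((abs_real_inner_le_norm _ _).trans (by gcongr))
    have h5 : -⟪y - x, f'' x (y - x)⟫_ℝ ≤ Lf * ‖y - x‖ ^ 2 := by
      refine (neg_le_abs _).trans ((abs_real_inner_le_norm _ _).trans ?_)
      have := (f'' x).le_of_opNorm_le (hnorm x hxr) (y - x)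
      nlinarith [norm_nonneg (y - x)]
    have h6 := hlow x hxr
    have h7 := le_abs_self (F0 - f xb + 1 - γ)
    have h8 : 0 ≤ Lf * ‖y - x‖ ^ 2 := by positivity
    linarith
  · intro hD
    have hxr : x ∈ ball xb r := ball_subset_ball (by linarith) hx
    have hy : y ∈ ball xb r := by
      rw [mem_ball_iff_norm] at hx ⊢
      have h1 := hD.trans_le (min_le_left _ _)
      have : y - xb = (y - x) + (x - xb) := by abel
      rw [this]
      linarith [norm_add_le (y - x) (x - xb)]
    have h := sub_quadratic_model_le (convex_ball xb r) hf1 hf2 hlip hK hxr hy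
    linarith

end Aux

/-- Proposition 4.1: for q ∈ (2,3], near any second-order stationary point x̄ ∈ 𝒳*,
eventually ‖y^k - x^k‖ ≤ c₁ dist(x^k, 𝒳*). -/
theorem step_bounded_by_distance_to_second_order_set
    {X : Type*} [NormedAddCommGroup X] [InnerProductSpace ℝ X] [FiniteDimensional ℝ X]
    -- the data of problem (1): f twice continuously differentiable on an open set O ⊇ dom g,
    -- g proper lsc convex, F = f + g bounded below
    (f : X → ℝ) (g : X → EReal) (f' : X → X) (f'' : X → X →L[ℝ] X)
    (O : Set X) (hO : IsOpen O) (hOdom : {z : X | g z ≠ ⊤} ⊆ O)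
    (hgproper : ∃ z : X, g z ≠ ⊤) (hgnebot : ∀ z : X, g z ≠ ⊥)
    (hglsc : LowerSemicontinuous g)
    (hgconv : ∀ u w : X, ∀ t : ℝ, t ∈ Set.Ioo (0:ℝ) 1 →
        g (t • u + (1 - t) • w) ≤ (t : EReal) * g u + ((1 - t : ℝ) : EReal) * g w)
    (hf1 : ∀ z ∈ O, HasGradientAt f (f' z) z)
    (hf2 : ∀ z ∈ O, HasFDerivAt f' (f'' z) z)
    (hf2c : ContinuousOn f'' O)
    -- the proximal mapping of g
    (proxg : X → X)
    (hproxg : ∀ w z : X,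
        ((1/2 * ‖proxg w - w‖ ^ 2 : ℝ) : EReal) + g (proxg w) ≤
          ((1/2 * ‖z - w‖ ^ 2 : ℝ) : EReal) + g z)
    (F : X → EReal) (hF : ∀ z : X, F z = (f z : EReal) + g z)
    (hFbdd : ∃ m : ℝ, ∀ z : X, (m : EReal) ≤ F z)
    -- Algorithm 1 parameters
    (q Lmin Lmax ϱ σ τ : ℝ)
    (hq : q ∈ Set.Ioc (2:ℝ) 3) (hLmin : 0 < Lmin) (hLmm : Lmin < Lmax)
    (hϱ : ϱ ∈ Set.Ioo (0:ℝ) 1) (hσ : σ ∈ Set.Ioo (0:ℝ) 1) (hτ : 1 < τ)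
    -- the sequences generated by Algorithm 1
    (x y v : ℕ → X) (L L0 : ℕ → ℝ) (j : ℕ → ℕ)
    (hx0 : g (x 0) ≠ ⊤)
    (hL0 : ∀ k : ℕ, L0 k ∈ Set.Icc Lmin Lmax)
    (hLdef : ∀ k : ℕ, L k = τ ^ j k * L0 k)
    -- the quadratic model ϑ_k, the regularized model objective Θ_{k,L} and its KKT residual map
    (ϑ : ℕ → X → ℝ)
    (hϑ : ∀ k : ℕ, ∀ z : X, ϑ k z = f (x k) + ⟪f' (x k), z - x k⟫_ℝ
        + 1/2 * ⟪z - x k, f'' (x k) (z - x k)⟫_ℝ)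
    (Θ : ℕ → ℝ → X → EReal)
    (hΘ : ∀ k : ℕ, ∀ l : ℝ, ∀ z : X,
        Θ k l z = ((ϑ k z + l / q * ‖z - x k‖ ^ q : ℝ) : EReal) + g z)
    (Rk : ℕ → ℝ → X → X)
    (hRk : ∀ k : ℕ, ∀ l : ℝ, ∀ z : X, Rk k l z = z - proxg (z -
        (f' (x k) + f'' (x k) (z - x k) + (l * ‖z - x k‖ ^ (q - 2)) • (z - x k))))
    -- inexactness criterion and descent condition at each iteration
    (hydom : ∀ k : ℕ, g (y k) ≠ ⊤)
    (hinex1 : ∀ k : ℕ, ‖Rk k (L k) (y k)‖ ≤ ϱ * L k * ‖y k - x k‖ ^ (q - 1))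
    (hinex2 : ∀ k : ℕ, Θ k (L k) (y k) < Θ k (L k) (x k))
    (hdesc : ∀ k : ℕ, F (y k) ≤ F (x k) - ((σ * L k / q * ‖y k - x k‖ ^ q : ℝ) : EReal))
    (hv : ∀ k : ℕ, v k = Rk k (L k) (y k))
    (hxsucc : ∀ k : ℕ, x (k + 1) = if F (y k) < F (y k - v k) then y k else y k - v k)
    -- if j_k ≥ 1, the previous trial point failed the descent test
    (hback : ∀ k : ℕ, 1 ≤ j k → ∃ yt : X, g yt ≠ ⊤ ∧
        ‖Rk k (L k / τ) yt‖ ≤ ϱ * (L k / τ) * ‖yt - x k‖ ^ (q - 1) ∧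
        Θ k (L k / τ) yt < Θ k (L k / τ) (x k) ∧
        F (x k) - ((σ * (L k / τ) / q * ‖yt - x k‖ ^ q : ℝ) : EReal) < F yt)
    -- Assumption 2: bounded level set; ∇²f locally Lipschitz on an open convex set N ⊇ ω(x⁰)
    (hlevel : Bornology.IsBounded {z : X | F z ≤ F (x 0)})
    (N : Set X) (hNopen : IsOpen N) (hNconv : Convex ℝ N)
    (hNomega : {z : X | MapClusterPt z atTop x} ⊆ N)
    (hHloc : ∀ z ∈ N, ∃ K : ℝ, 0 < K ∧ ∃ δ : ℝ, 0 < δ ∧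
        ∀ a ∈ Metric.ball z δ ∩ N, ∀ b ∈ Metric.ball z δ ∩ N,
          ‖f'' a - f'' b‖ ≤ K * ‖a - b‖)
    -- ϱ < (1-ς)/(1+ς+L_f), with L_f a Lipschitz constant of ∇f on ℒ_F(x⁰) + μ̄𝔹
    (ς μb Lf : ℝ) (hς : ς ∈ Set.Ioo (0:ℝ) 1) (hμb : μb ∈ Set.Ioo (0:ℝ) 1)
    (hLf : ∀ a ∈ {z : X | F z ≤ F (x 0)} + Metric.closedBall (0:X) μb,
           ∀ b ∈ {z : X | F z ≤ F (x 0)} + Metric.closedBall (0:X) μb,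
           ‖f' a - f' b‖ ≤ Lf * ‖a - b‖)
    (hϱLf : ϱ < (1 - ς) / (1 + ς + Lf)) :
    ∀ xb : X,
      (-f' xb ∈ ESubdiff g xb ∧
        ∀ u : X, 0 ≤ ⟪proxg u - xb, f'' xb (proxg u - xb)⟫_ℝ) →
      ∃ c1 : ℝ, 0 < c1 ∧ ∃ δ : ℝ, 0 < δ ∧ ∃ kb : ℕ, ∀ k : ℕ, kb ≤ k →
        x k ∈ Metric.ball xb δ →
        ‖y k - x k‖ ≤ c1 * Metric.infDist (x k)
          {z : X | -f' z ∈ ESubdiff g z ∧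
            ∀ u : X, 0 ≤ ⟪proxg u - z, f'' z (proxg u - z)⟫_ℝ} := by
  intro xb hxb
  obtain ⟨hq2, hq3⟩ := hq
  have hq0 : 0 < q := by linarith
  rcases subsingleton_or_nontrivial X with hX | hX
  · refine ⟨1, one_pos, 1, one_pos, 0, fun k _ _ => ?_⟩
    rw [Subsingleton.elim (y k - x k) 0, norm_zero, one_mul]
    exact infDist_nonneg
  -- the iterates stay in the domain and the objective values decrease
  have hydef : ∀ k, y k - v k = proxg (y k - (f' (x k) + f'' (x k) (y k - x k) +
      (L k * ‖y k - x k‖ ^ (q - 2)) • (y k - x k))) := fun k => by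
    rw [hv, hRk, sub_sub_cancel]
  have hgx : ∀ k, g (x k) ≠ ⊤ := by
    rintro (_ | k)
    · exact hx0
    · rw [hxsucc]
      split_ifs
      · exact hydom k
      · rw [hydef]
        exact prox_ne_top hgproper (hproxg _)
  choose Gx hGx using fun k => EReal.exists_real_eq (hgx k) (hgnebot (x k))
  choose Gy hGy using fun k => EReal.exists_real_eq (hydom k) (hgnebot (y k))
  have hFx : ∀ k, F (x k) = ((f (x k) + Gx k : ℝ) : EReal) := fun k => by
    rw [hF, hGx, EReal.coe_add]
  have hLk : ∀ k, Lmin ≤ L k := fun k => by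
    rw [hLdef]
    exact (hL0 k).1.trans (le_mul_of_one_le_left (hLmin.le.trans (hL0 k).1)
      (one_le_pow₀ hτ.le))
  have hLpos : ∀ k, 0 < L k := fun k => hLmin.trans_le (hLk k)
  have hdec : ∀ k, f (x (k + 1)) + Gx (k + 1) ≤
      f (x k) + Gx k - σ * Lmin / q * ‖y k - x k‖ ^ q := fun k => by
    have h1 : F (x (k + 1)) ≤ F (y k) := by
      rw [hxsucc]
      split_ifs with h
      · exact le_rfl
      · exact not_lt.1 h
    have h2 := h1.trans (hdesc k)
    rw [hFx, hFx] at h2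
    norm_cast at h2
    have h3 : σ * Lmin / q * ‖y k - x k‖ ^ q ≤ σ * L k / q * ‖y k - x k‖ ^ q := by
      have := hσ.1.le
      have := hLk k
      gcongr
    linarith
  have hcpos : 0 < σ * Lmin / q := by have := hσ.1; positivity
  have hD0 : Tendsto (fun k => ‖y k - x k‖) atTop (𝓝 0) := by
    obtain ⟨m, hm⟩ := hFbdd
    refine tendsto_zero_of_sufficient_decrease (Φ := fun k => f (x k) + Gx k) hcpos hq0
      (m := m) (fun k => ?_) (fun k => norm_nonneg _) hdec
    have := hm (x k)
    rw [hFx] at this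
    exact_mod_cast this
  have hanti : Antitone fun k => f (x k) + Gx k := antitone_nat_of_succ_le fun k =>
    (hdec k).trans (sub_le_self _ (by positivity))
  have hlev : ∀ k, x k ∈ {z : X | F z ≤ F (x 0)} := fun k => by
    simp only [mem_ofPred_eq, hFx]
    exact_mod_cast hanti (Nat.zero_le k)
  -- away from cluster points there is nothing to prove
  by_cases hcl : MapClusterPt xb atTop x
  swap
  · rw [mapClusterPt_iff_frequently] at hcl
    push Not at hcl
    obtain ⟨s, hs, hsx⟩ := hcl
    obtain ⟨δ, hδ, hδs⟩ := Metric.mem_nhds_iff.1 hs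
    obtain ⟨kb, hkb⟩ := eventually_atTop.1 hsx
    exact ⟨1, one_pos, δ, hδ, kb, fun k hk hxk => absurd (hδs hxk) (hkb k hk)⟩
  -- a ball on which all local regularity holds
  have hxbO : xb ∈ O := hOdom (ESubdiff.ne_top hgproper hxb.1)
  obtain ⟨K, hK, δ₀, hδ₀, hKlip⟩ := hHloc xb (hNomega hcl)
  have hlevnhds : {z : X | F z ≤ F (x 0)} + Metric.closedBall (0:X) μb ∈ 𝓝 xb := by
    obtain ⟨k, hk⟩ := (mapClusterPt_iff_frequently.1 hcl _
      (ball_mem_nhds xb (half_pos hμb.1))).exists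
    refine Filter.mem_of_superset (ball_mem_nhds xb (half_pos hμb.1)) fun z hz => ?_
    refine Set.mem_add.2 ⟨x k, hlev k, z - x k, ?_, by abel⟩
    rw [mem_closedBall_zero_iff, ← dist_eq_norm]
    have h1 := mem_ball.1 hk
    have h2 := mem_ball.1 hz
    linarith [dist_triangle_right z (x k) xb]
  have hlownhds : {z | f xb - 1 < f z} ∈ 𝓝 xb :=
    (hf1 xb hxbO).hasFDerivAt.continuousAt.eventually (lt_mem_nhds (by linarith))
  obtain ⟨r, hr, hrsub⟩ := Metric.mem_nhds_iff.1 (Filter.inter_mem (Filter.inter_mem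
    (hO.mem_nhds hxbO) hlevnhds) (Filter.inter_mem hlownhds (Filter.inter_mem
    (ball_mem_nhds xb hδ₀) (hNopen.mem_nhds (hNomega hcl)))))
  have hBf1 : ∀ z ∈ ball xb r, HasGradientAt f (f' z) z := fun z hz => hf1 z (hrsub hz).1.1
  have hBf2 : ∀ z ∈ ball xb r, HasFDerivAt f' (f'' z) z := fun z hz => hf2 z (hrsub hz).1.1
  have hBlip : ∀ a ∈ ball xb r, ∀ b ∈ ball xb r, ‖f'' a - f'' b‖ ≤ K * ‖a - b‖ :=
    fun a ha b hb => hKlip a (hrsub ha).2.2 b (hrsub hb).2.2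
  have hBlip' : ∀ a ∈ ball xb r, ∀ b ∈ ball xb r, ‖f' a - f' b‖ ≤ Lf * ‖a - b‖ :=
    fun a ha b hb => hLf a (hrsub ha).1.2 b (hrsub hb).1.2
  have hLf0 : 0 ≤ Lf := by
    obtain ⟨e, he⟩ := NormedSpace.exists_lt_norm ℝ X 0
    have hmem : xb + (r / 2 / ‖e‖) • e ∈ ball xb r := by
      rw [mem_ball_iff_norm, add_sub_cancel_left, norm_smul, Real.norm_of_nonneg (by positivity),
        div_mul_cancel₀ _ he.ne']
      linarith
    have h := (norm_nonneg _).trans (hBlip' _ hmem xb (mem_ball_self hr))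
    rw [add_sub_cancel_left, norm_smul, Real.norm_of_nonneg (by positivity),
        div_mul_cancel₀ _ he.ne'] at h
    exact nonneg_of_mul_nonneg_left h (by positivity)
  have hnorm : ∀ z ∈ ball xb r, ‖f'' z‖ ≤ Lf := fun z hz =>
    (hBf2 z hz).le_of_lip' hLf0 (Filter.mem_of_superset (isOpen_ball.mem_nhds hz)
      fun a ha => hBlip' a ha z hz)
  obtain ⟨M, hM⟩ := exists_bound_of_failed_descent (F0 := f (x 0) + Gx 0) hr hK.le hLf0
    ⟨hq2, hq3⟩ hσ.2 hgproper hgnebot hxb.1 hBf1 hBf2 hBlip hBlip' hnorm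
    (fun z hz => (hrsub hz).2.1.le)
  have hLbound : ∀ k, x k ∈ ball xb (r / 2) → L k ≤ Lmax + τ * |M| := fun k hk => by
    have hτ0 : 0 < τ := by linarith
    rcases Nat.eq_zero_or_pos (j k) with hj | hj
    · rw [hLdef, hj, pow_zero, one_mul]
      have : 0 ≤ τ * |M| := by positivity
      linarith [(hL0 k).2]
    · obtain ⟨yt, hyt, -, hmodel, hfail⟩ := hback k hj
      obtain ⟨b, hb⟩ := EReal.exists_real_eq hyt (hgnebot yt)
      have hΘx : Θ k (L k / τ) (x k) = ((f (x k) + Gx k : ℝ) : EReal) := by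
        rw [hΘ, hϑ, hGx, EReal.coe_add]
        simp [zero_rpow hq0.ne']
      rw [hΘx, hΘ, hϑ, hb] at hmodel
      rw [hFx, hF, hb] at hfail
      norm_cast at hmodel hfail
      have h := hM (x k) hk yt (Gx k) b (L k / τ) (hGx k) hb (div_pos (hLpos k) hτ0)
        (hanti (Nat.zero_le k)) hmodel (by
          have : σ * (L k / τ / q * ‖yt - x k‖ ^ q) = σ * (L k / τ) / q * ‖yt - x k‖ ^ q := by
            ring
          rw [this]
          exact hfail)
      rw [div_le_iff₀ hτ0] at h
      have := mul_le_mul_of_nonneg_left (le_abs_self M) hτ0.le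
      linarith [hL0 k |>.1]
  -- constants
  have hς0 := hς.1
  have hden : 0 < 1 + ς + Lf := by linarith
  have hϱ1 : (1 + Lf) * ϱ ≤ 1 - ς := by
    rw [lt_div_iff₀ hden] at hϱLf
    nlinarith [mul_pos hϱ.1 hς0]
  obtain ⟨θ, hθ, hθ1, hθ2⟩ : ∃ θ : ℝ, 0 < θ ∧ θ ≤ ς / 16 ∧ 2 * K * θ ≤ ς / 8 * Lmin := by
    refine ⟨min (ς / 16) (ς / 8 * Lmin / (2 * K)), by positivity, min_le_left _ _, ?_⟩
    have := min_le_right (ς / 16) (ς / 8 * Lmin / (2 * K))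
    rwa [le_div_iff₀' (by positivity)] at this
  have hev : ∀ᶠ k in atTop, ‖y k - x k‖ ≤ 1 ∧
      (Lmax + τ * |M|) * ‖y k - x k‖ ^ (q - 2) ≤ ς / 16 := by
    have h1 := hD0.rpow_const (p := q - 2) (Or.inr (by linarith))
    rw [zero_rpow (by linarith)] at h1
    have h2 := h1.const_mul (Lmax + τ * |M|)
    rw [mul_zero] at h2
    exact (hD0.eventually (ge_mem_nhds one_pos)).and
      (h2.eventually (ge_mem_nhds (by positivity)))
  obtain ⟨kb, hkb⟩ := eventually_atTop.1 hev
  -- the estimate for nearby second-order stationary points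
  have hnear : ∀ k, kb ≤ k → x k ∈ ball xb (r / 2) → ∀ z ∈ ball xb r,
      -f' z ∈ ESubdiff g z → (∀ u : X, 0 ≤ ⟪proxg u - z, f'' z (proxg u - z)⟫_ℝ) →
      θ * ‖y k - x k‖ ≤ ‖x k - z‖ := by
    intro k hk hxk z hz hz1 hz2
    obtain ⟨hD1, hs⟩ := hkb k hk
    rcases (norm_nonneg (y k - x k)).eq_or_lt with hD | hD
    · rw [← hD, mul_zero]; exact norm_nonneg _
    have hxr : x k ∈ ball xb r := ball_subset_ball (by linarith) hxk
    have hsub := sub_prox_mem_ESubdiff hgproper hgnebot hgconv (hproxg (y k -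
      (f' (x k) + f'' (x k) (y k - x k) + (L k * ‖y k - x k‖ ^ (q - 2)) • (y k - x k))))
    have hmono := ESubdiff.inner_sub_nonneg hgproper hgnebot hsub hz1
    have hpsd := hz2 (y k -
      (f' (x k) + f'' (x k) (y k - x k) + (L k * ‖y k - x k‖ ^ (q - 2)) • (y k - x k)))
    rw [← hydef k] at hmono hpsd
    have heq : y k - (f' (x k) + f'' (x k) (y k - x k) +
        (L k * ‖y k - x k‖ ^ (q - 2)) • (y k - x k)) - (y k - v k) - -f' z =
        v k - (f' (x k) + f'' (x k) (y k - x k) +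
        (L k * ‖y k - x k‖ ^ (q - 2)) • (y k - x k)) + f' z := by abel
    rw [heq] at hmono
    have hs0 : 0 ≤ L k * ‖y k - x k‖ ^ (q - 2) :=
      mul_nonneg (hLpos k).le (rpow_nonneg (norm_nonneg _) _)
    have hmain := step_residual_inequality hs0 hmono hpsd (hnorm z hz)
      (norm_sub_sub_fderiv_le (convex_ball xb r) hBf2 hBlip hK.le hxr hz)
      (hBlip _ hxr _ hz)
    have hV : ‖v k‖ ≤ ϱ * (L k * ‖y k - x k‖ ^ (q - 2)) * ‖y k - x k‖ := by
      have h1 := hinex1 k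
      rw [← hv] at h1
      have h2 : ‖y k - x k‖ ^ (q - 1) = ‖y k - x k‖ ^ (q - 2) * ‖y k - x k‖ := by
        rw [← rpow_add_one hD.ne']; congr 1; ring
      rw [h2] at h1
      linarith
    have hD2 : ‖y k - x k‖ ≤ ‖y k - x k‖ ^ (q - 2) := by
      simpa using rpow_le_rpow_of_exponent_ge hD hD1 (show q - 2 ≤ 1 by linarith)
    exact step_le_of_residual_inequality hD (norm_nonneg _) (norm_nonneg _) hV hϱ hς hLf0 hK.le
      hLmin hϱ1 (mul_le_mul (hLk k) hD2 hD.le (hLpos k).le)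
      ((mul_le_mul_of_nonneg_right (hLbound k hxk) (rpow_nonneg hD.le _)).trans hs)
      hθ hθ1 hθ2 hmain
  refine ⟨1 / θ, by positivity, r / 4, by positivity, kb, fun k hk hxk => ?_⟩
  have hxk' : x k ∈ ball xb (r / 2) := ball_subset_ball (by linarith) hxk
  rw [one_div, ← div_eq_inv_mul, le_div_iff₀' hθ]
  refine (le_infDist ⟨xb, hxb⟩).2 fun z hz => ?_
  rcases lt_or_ge (dist (x k) z) (r / 4) with h | h
  · rw [dist_eq_norm]
    refine hnear k hk hxk' z ?_ hz.1 hz.2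
    have h1 := mem_ball.1 hxk
    rw [mem_ball]
    linarith [dist_triangle_left z xb (x k)]
  · have h1 := hnear k hk hxk' xb (mem_ball_self hr) hxb.1 hxb.2
    rw [← dist_eq_norm (x k)] at h1
    linarith [mem_ball.1 hxk]
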